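/- Let n, p be positive integers, α_N, α_a, ω, ω̄, γ, γ̄ > 0, σ ≥ 0, c ≥ 0, d̄ ≥ 0, and suppose the 2×2 symmetric matrix [[-2α_N/ω̄, c], [c, -2σ]] ⪯ -2α_a·diag(1/ω, 1/γ) in the Loewner order. Let M be a real symmetric n×n matrix with M ⪯ (1/ω)·I, Γ a real symmetric positive definite p×p matrix with γ·I ⪯ Γ, e ∈ ℝⁿ, θ̃ ∈ ℝᵖ, and V = eᵀM e + θ̃ᵀΓ⁻¹θ̃. Then -2(α_N/ω̄)‖e‖² + 2c‖e‖‖θ̃‖ - 2σ‖θ̃‖² + 2d̄√V ≤ -2α_a·V + 2d̄·√V. -/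

import Mathlib

open Matrix

namespace Matrix

variable {ι : Type*} [Fintype ι]

theorem dotProduct_mulVec_le_of_posSemidef_smul_one_sub [DecidableEq ι] {A : Matrix ι ι ℝ} {a : ℝ}
    (h : (a • (1 : Matrix ι ι ℝ) - A).PosSemidef) (x : ι → ℝ) :
    x ⬝ᵥ A *ᵥ x ≤ a * (x ⬝ᵥ x) := by
  have hx := h.dotProduct_mulVec_nonneg x
  simp only [star_trivial, sub_mulVec, smul_mulVec, one_mulVec, dotProduct_sub, dotProduct_smul,
    smul_eq_mul] at hx
  linarith

theorem le_dotProduct_mulVec_of_posSemidef_sub_smul_one [DecidableEq ι] {A : Matrix ι ι ℝ} {a : ℝ}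
    (h : (A - a • (1 : Matrix ι ι ℝ)).PosSemidef) (x : ι → ℝ) :
    a * (x ⬝ᵥ x) ≤ x ⬝ᵥ A *ᵥ x := by
  have hx := h.dotProduct_mulVec_nonneg x
  simp only [star_trivial, sub_mulVec, smul_mulVec, one_mulVec, dotProduct_sub, dotProduct_smul,
    smul_eq_mul] at hx
  linarith

theorem dotProduct_inv_mulVec_le [DecidableEq ι] {A : Matrix ι ι ℝ} {a : ℝ} (ha : 0 < a)
    (hA : IsUnit A.det) (h : (A - a • (1 : Matrix ι ι ℝ)).PosSemidef) (x : ι → ℝ) :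
    x ⬝ᵥ A⁻¹ *ᵥ x ≤ 1 / a * (x ⬝ᵥ x) := by
  set y := A⁻¹ *ᵥ x with hy
  have hAy : A *ᵥ y = x := by rw [hy, mulVec_mulVec, mul_nonsing_inv _ hA, one_mulVec]
  have hlow := le_dotProduct_mulVec_of_posSemidef_sub_smul_one h y
  rw [hAy, dotProduct_comm y x] at hlow
  have hsq : 0 ≤ (x - a • y) ⬝ᵥ (x - a • y) := by
    simpa using dotProduct_star_self_nonneg (x - a • y)
  simp only [sub_dotProduct, dotProduct_sub, dotProduct_smul, smul_dotProduct, smul_eq_mul,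
    dotProduct_comm y x] at hsq
  rw [one_div_mul_eq_div, le_div_iff₀ ha]
  nlinarith [mul_le_mul_of_nonneg_left hlow ha.le]

end Matrix

theorem EuclideanSpace.dotProduct_self_eq_norm_sq {ι : Type*} [Fintype ι]
    (x : EuclideanSpace ℝ ι) : (x : ι → ℝ) ⬝ᵥ x = ‖x‖ ^ 2 := by
  simp [EuclideanSpace.real_norm_sq_eq, dotProduct, ← sq]

/-- the chain of estimates by which the LMI condition turns the Lyapunov
derivative bound in `(‖e‖, ‖θ̃‖)` into `-2α_a·V + 2d̄·√V` for `V = eᵀM e + θ̃ᵀΓ⁻¹θ̃`. -/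
theorem stmt_8 (n p : ℕ) (hn : 0 < n) (hp : 0 < p)
    (αN αa ω ωb γ γb : ℝ)
    (hαN : 0 < αN) (hαa : 0 < αa) (hω : 0 < ω) (hωb : 0 < ωb) (hγ : 0 < γ) (hγb : 0 < γb)
    (σ c db : ℝ) (hσ : 0 ≤ σ) (hc : 0 ≤ c) (hdb : 0 ≤ db)
    (hLMI : (((-2 * αa) • Matrix.diagonal ![1 / ω, 1 / γ] -
        !![-2 * αN / ωb, c; c, -2 * σ])).PosSemidef)
    (M : Matrix (Fin n) (Fin n) ℝ) (hMsymm : M.IsHermitian)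
    (hMub : ((1 / ω) • (1 : Matrix (Fin n) (Fin n) ℝ) - M).PosSemidef)
    (Γ : Matrix (Fin p) (Fin p) ℝ) (hΓ : Γ.PosDef)
    (hΓlb : (Γ - γ • (1 : Matrix (Fin p) (Fin p) ℝ)).PosSemidef)
    (e : EuclideanSpace ℝ (Fin n)) (θt : EuclideanSpace ℝ (Fin p)) (V : ℝ)
    (hV : V = e ⬝ᵥ M.mulVec e + θt ⬝ᵥ Γ⁻¹.mulVec θt) :
    -2 * (αN / ωb) * ‖e‖ ^ 2 + 2 * c * ‖e‖ * ‖θt‖ - 2 * σ * ‖θt‖ ^ 2 + 2 * db * Real.sqrt V ≤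
      -2 * αa * V + 2 * db * Real.sqrt V := by
  have hM := dotProduct_mulVec_le_of_posSemidef_smul_one_sub hMub e
  have hΓinv := dotProduct_inv_mulVec_le hγ hΓ.det_pos.ne'.isUnit hΓlb θt
  rw [EuclideanSpace.dotProduct_self_eq_norm_sq] at hM hΓinv
  have hquad := hLMI.dotProduct_mulVec_nonneg ![‖e‖, ‖θt‖]
  simp [mulVec, dotProduct, Fin.sum_univ_two] at hquad
  have hVle : V ≤ 1 / ω * ‖e‖ ^ 2 + 1 / γ * ‖θt‖ ^ 2 := hV ▸ add_le_add hM hΓinv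
  have hscaled := mul_le_mul_of_nonneg_left hVle hαa.le
  simp only [div_eq_mul_inv] at hquad hscaled ⊢
  nlinarith only [hquad, hscaled]
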